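/- arXiv:1709.08163 — 2 statements merged into one kernel-verified Lean document; each statement's English description precedes it below -/
import Mathlib

section
/- Let N ≥ 1, let w(i,j) be strictly positive real numbers defined for all 0 ≤ i < j ≤ N+1, and let k ∈ {1,...,N}. Define a_1,...,a_N by the forward recurrence a_m = w(0,m) + Σ_{j=1}^{m-1} a_j · w(j,m), b_N,...,b_1 by the backward recurrence b_m = w(m,N+1) + Σ_{j=m+1}^{N} w(m,j) · b_j, and A = w(0,N+1) + Σ_{j=1}^{N} a_j · w(j,N+1). Then A > 0 and (Σ_{I ⊆ {1,...,N}, k ∈ I} Π(I)) / A = 1 − (a_k · b_k) / A, where Π(I) is the weight of the chain through {0} ∪ ({1,...,N} \ I) ∪ {N+1} in increasing order. -/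
/-- The weight of a chain, given as the list of its vertices:
the product of `w` over consecutive pairs of vertices. -/
noncomputable def chainWeight (w : ℕ → ℕ → ℝ) : List ℕ → ℝ
  | a :: b :: rest => w a b * chainWeight w (b :: rest)
  | _ => 1

/-- The chain from `i` to `j` whose intermediate vertices are the
elements of `S`, taken in increasing order. -/
def chainList (i j : ℕ) (S : Finset ℕ) : List ℕ :=
  (i :: S.sort (· ≤ ·)) ++ [j]

/-- The sum, over all strictly increasing finite sequences
`i = c_0 < c_1 < ... < c_m = j` (`m ≥ 1`), of the products
`Π_{l=0}^{m-1} w(c_l, c_{l+1})`.  Such chains are in bijection with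
finite sets `S ⊆ Ioo i j` of intermediate vertices. -/
noncomputable def chainSum (w : ℕ → ℕ → ℝ) (i j : ℕ) : ℝ :=
  ∑ S ∈ (Finset.Ioo i j).powerset, chainWeight w (chainList i j S)

/-- `Π(I)`: the weight of the chain through `{0} ∪ ({1,...,N} \ I) ∪ {N+1}`
in increasing order. -/
noncomputable def PiW (w : ℕ → ℕ → ℝ) (N : ℕ) (I : Finset ℕ) : ℝ :=
  chainWeight w (chainList 0 (N + 1) (Finset.Icc 1 N \ I))

theorem chainWeight_append (w : ℕ → ℕ → ℝ) (l : List ℕ) (k : ℕ) (r : List ℕ) :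
    chainWeight w (l ++ k :: r) = chainWeight w (l ++ [k]) * chainWeight w (k :: r) := by
  induction l with
  | nil => simp [chainWeight]
  | cons x l ih =>
    cases l with
    | nil => simp [chainWeight]
    | cons y l =>
      simp only [List.cons_append, chainWeight] at ih ⊢
      rw [ih, mul_assoc]

theorem sort_insert_union {S T : Finset ℕ} {k : ℕ} (hS : ∀ x ∈ S, x < k) (hT : ∀ x ∈ T, k < x) :
    (insert k (S ∪ T)).sort (· ≤ ·) = S.sort (· ≤ ·) ++ k :: T.sort (· ≤ ·) := by
  have hsorted : (S.sort (· ≤ ·) ++ k :: T.sort (· ≤ ·)).SortedLT := by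
    rw [List.sortedLT_iff_pairwise, List.pairwise_append, List.pairwise_cons]
    refine ⟨(Finset.sortedLT_sort S).pairwise, ⟨by simpa using hT,
      (Finset.sortedLT_sort T).pairwise⟩, ?_⟩
    intro x hx y hy
    have hxk := hS x (by simpa using hx)
    rcases List.mem_cons.1 hy with rfl | hy
    · exact hxk
    · exact hxk.trans (hT y (by simpa using hy))
  refine List.Perm.eq_of_pairwise' (Finset.sortedLT_sort _).pairwise hsorted.pairwise ?_
  refine (List.perm_ext_iff_of_nodup (Finset.sort_nodup _ _) hsorted.nodup).2 fun x => ?_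
  simp only [Finset.mem_sort, Finset.mem_insert, Finset.mem_union, List.mem_append, List.mem_cons]
  tauto

theorem chainWeight_insert_union (w : ℕ → ℕ → ℝ) {S T : Finset ℕ} {i j k : ℕ}
    (hS : ∀ x ∈ S, x < k) (hT : ∀ x ∈ T, k < x) :
    chainWeight w (chainList i j (insert k (S ∪ T))) =
      chainWeight w (chainList i k S) * chainWeight w (chainList k j T) := by
  have h := chainWeight_append w (i :: S.sort (· ≤ ·)) k (T.sort (· ≤ ·) ++ [j])
  simpa [chainList, sort_insert_union hS hT] using h

theorem chainWeight_chainList_empty (w : ℕ → ℕ → ℝ) (i j : ℕ) :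
    chainWeight w (chainList i j ∅) = w i j := by
  simp [chainList, chainWeight]

/-- The chains from `i` to `j` through `k` contribute `chainSum w i k * chainSum w k j`. -/
theorem sum_chainWeight_mem (w : ℕ → ℕ → ℝ) {i j k : ℕ} (hik : i < k) (hkj : k < j) :
    ∑ S ∈ (Finset.Ioo i j).powerset with k ∈ S, chainWeight w (chainList i j S) =
      chainSum w i k * chainSum w k j := by
  rw [chainSum, chainSum, Finset.sum_mul_sum, ← Finset.sum_product']
  symm
  refine Finset.sum_nbij' (fun P => insert k (P.1 ∪ P.2))
    (fun S => (S.filter (· < k), S.filter (k < ·))) ?_ ?_ ?_ ?_ ?_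
  · rintro ⟨S, T⟩ h
    simp only [Finset.mem_product, Finset.mem_powerset, Finset.subset_iff, Finset.mem_Ioo,
      Finset.mem_filter, Finset.mem_insert, Finset.mem_union] at h ⊢
    grind
  · intro S h
    simp only [Finset.mem_product, Finset.mem_powerset, Finset.subset_iff, Finset.mem_Ioo,
      Finset.mem_filter] at h ⊢
    grind
  · rintro ⟨S, T⟩ h
    simp only [Finset.mem_product, Finset.mem_powerset, Finset.subset_iff, Finset.mem_Ioo] at h
    ext x <;> simp only [Finset.mem_filter, Finset.mem_insert, Finset.mem_union] <;> grind
  · intro S h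
    simp only [Finset.mem_filter] at h
    ext x
    simp only [Finset.mem_filter, Finset.mem_insert, Finset.mem_union]
    grind
  · rintro ⟨S, T⟩ h
    simp only [Finset.mem_product, Finset.mem_powerset, Finset.subset_iff, Finset.mem_Ioo] at h
    exact (chainWeight_insert_union w (fun x hx => (h.1 hx).2) (fun x hx => (h.2 hx).1)).symm

theorem sum_chainWeight_Ioo_left (w : ℕ → ℕ → ℝ) {i n : ℕ} (j : ℕ) (hin : i < n) :
    ∑ S ∈ (Finset.Ioo i n).powerset, chainWeight w (chainList i j S) =
      w i j + ∑ k ∈ Finset.Ioo i n, chainSum w i k * w k j := by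
  induction n, hin using Nat.le_induction with
  | base =>
    have h : Finset.Ioo i i.succ = ∅ := by ext x; simp
    simp [h, chainWeight_chainList_empty]
  | succ n hn ih =>
    have hn' : i < n := hn
    have h : Finset.Ioo i (n + 1) = insert n (Finset.Ioo i n) := by
      ext x; simp only [Finset.mem_Ioo, Finset.mem_insert]; omega
    have hnot : n ∉ Finset.Ioo i n := by simp
    rw [h, Finset.sum_powerset_insert hnot, Finset.sum_insert hnot, ih, chainSum, Finset.sum_mul]
    have hsplit : ∀ S ∈ (Finset.Ioo i n).powerset, chainWeight w (chainList i j (insert n S)) =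
        chainWeight w (chainList i n S) * w n j := by
      intro S hS
      have hlt : ∀ x ∈ S, x < n := fun x hx =>
        (Finset.mem_Ioo.1 (Finset.mem_powerset.1 hS hx)).2
      simpa [chainWeight_chainList_empty] using
        chainWeight_insert_union w (i := i) (j := j) (T := ∅) hlt (by simp)
    rw [Finset.sum_congr rfl hsplit]
    ring

theorem sum_chainWeight_Ioo_right (w : ℕ → ℕ → ℝ) (i : ℕ) {n j : ℕ} (hnj : n < j) :
    ∑ S ∈ (Finset.Ioo n j).powerset, chainWeight w (chainList i j S) =
      w i j + ∑ k ∈ Finset.Ioo n j, w i k * chainSum w k j := by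
  obtain ⟨d, rfl⟩ : ∃ d, j = n + d + 1 := ⟨j - n - 1, by omega⟩
  clear hnj
  induction d generalizing n with
  | zero =>
    have h : Finset.Ioo n (n + 0 + 1) = ∅ := by ext x; simp
    simp [h, chainWeight_chainList_empty]
  | succ d ih =>
    have h : Finset.Ioo n (n + (d + 1) + 1) =
        insert (n + 1) (Finset.Ioo (n + 1) (n + (d + 1) + 1)) := by
      ext x; simp only [Finset.mem_Ioo, Finset.mem_insert]; omega
    have hnot : n + 1 ∉ Finset.Ioo (n + 1) (n + (d + 1) + 1) := by simp
    have ih' := ih (n := n + 1)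
    rw [show n + 1 + d + 1 = n + (d + 1) + 1 by ring] at ih'
    rw [h, Finset.sum_powerset_insert hnot, Finset.sum_insert hnot, ih', chainSum, Finset.mul_sum]
    have hsplit : ∀ S ∈ (Finset.Ioo (n + 1) (n + (d + 1) + 1)).powerset,
        chainWeight w (chainList i (n + (d + 1) + 1) (insert (n + 1) S)) =
        w i (n + 1) * chainWeight w (chainList (n + 1) (n + (d + 1) + 1) S) := by
      intro S hS
      have hlt : ∀ x ∈ S, n + 1 < x := fun x hx =>
        (Finset.mem_Ioo.1 (Finset.mem_powerset.1 hS hx)).1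
      simpa [chainWeight_chainList_empty] using
        chainWeight_insert_union w (i := i) (j := n + (d + 1) + 1) (S := ∅) (by simp) hlt
    rw [Finset.sum_congr rfl hsplit]
    ring

/-- Decomposition of `chainSum` by the last intermediate vertex. -/
theorem chainSum_eq_add_sum_last (w : ℕ → ℕ → ℝ) {i j : ℕ} (hij : i < j) :
    chainSum w i j = w i j + ∑ k ∈ Finset.Ioo i j, chainSum w i k * w k j :=
  sum_chainWeight_Ioo_left w j hij

/-- Decomposition of `chainSum` by the first intermediate vertex. -/
theorem chainSum_eq_add_sum_first (w : ℕ → ℕ → ℝ) {i j : ℕ} (hij : i < j) :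
    chainSum w i j = w i j + ∑ k ∈ Finset.Ioo i j, w i k * chainSum w k j :=
  sum_chainWeight_Ioo_right w i hij

theorem chainSum_pos {w : ℕ → ℕ → ℝ} {n i j : ℕ}
    (hw : ∀ i j, i < j → j ≤ n → 0 < w i j) (hij : i < j) (hjn : j ≤ n) :
    0 < chainSum w i j := by
  induction j using Nat.strong_induction_on with
  | _ j ih =>
    rw [chainSum_eq_add_sum_last w hij]
    refine add_pos_of_pos_of_nonneg (hw i j hij hjn) (Finset.sum_nonneg fun k hk => ?_)
    obtain ⟨hik, hkj⟩ := Finset.mem_Ioo.1 hk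
    exact (mul_pos (ih k hkj hik (hkj.le.trans hjn)) (hw k j hkj hjn)).le

theorem sum_PiW (w : ℕ → ℕ → ℝ) (N : ℕ) :
    ∑ I ∈ (Finset.Icc 1 N).powerset, PiW w N I = chainSum w 0 (N + 1) := by
  have hI : Finset.Ioo 0 (N + 1) = Finset.Icc 1 N := by
    ext x; simp only [Finset.mem_Ioo, Finset.mem_Icc]; omega
  rw [chainSum, hI]
  refine Finset.sum_nbij' (Finset.Icc 1 N \ ·) (Finset.Icc 1 N \ ·) ?_ ?_ ?_ ?_ fun _ _ => rfl
  all_goals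
    intro S hS
    simp_all

theorem sum_PiW_notMem (w : ℕ → ℕ → ℝ) {N k : ℕ} (hk1 : 1 ≤ k) (hkN : k ≤ N) :
    ∑ I ∈ (Finset.Icc 1 N).powerset with k ∉ I, PiW w N I =
      chainSum w 0 k * chainSum w k (N + 1) := by
  have hI : Finset.Ioo 0 (N + 1) = Finset.Icc 1 N := by
    ext x; simp only [Finset.mem_Ioo, Finset.mem_Icc]; omega
  rw [← sum_chainWeight_mem w hk1 (Nat.lt_succ_of_le hkN), hI]
  refine Finset.sum_nbij' (Finset.Icc 1 N \ ·) (Finset.Icc 1 N \ ·) ?_ ?_ ?_ ?_ fun _ _ => rfl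
  all_goals
    intro S hS
    simp_all

/-- with strictly positive weights, the normalizer `A` is
positive, and the normalized posterior marginal probability of `k` belonging
to the intrusion is `1 − a_k b_k / A`. -/
theorem marginal_intrusion_probability (N : ℕ) (hN : 1 ≤ N)
    (w : ℕ → ℕ → ℝ) (hw : ∀ i j, i < j → j ≤ N + 1 → 0 < w i j)
    (k : ℕ) (hk1 : 1 ≤ k) (hkN : k ≤ N)
    (a b : ℕ → ℝ) (A : ℝ)
    (ha : ∀ m, 1 ≤ m → m ≤ N →
      a m = w 0 m + ∑ j ∈ Finset.Ico 1 m, a j * w j m)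
    (hb : ∀ m, 1 ≤ m → m ≤ N →
      b m = w m (N + 1) + ∑ j ∈ Finset.Ioc m N, w m j * b j)
    (hA : A = w 0 (N + 1) + ∑ j ∈ Finset.Icc 1 N, a j * w j (N + 1)) :
    0 < A ∧
    (∑ I ∈ (Finset.Icc 1 N).powerset.filter (fun I => k ∈ I), PiW w N I) / A
      = 1 - a k * b k / A := by
  have hIco : ∀ m, Finset.Ico 1 m = Finset.Ioo 0 m := fun m => rfl
  have hIoc : ∀ m, Finset.Ioc m N = Finset.Ioo m (N + 1) := fun m => by
    ext x; simp only [Finset.mem_Ioo, Finset.mem_Ioc]; omega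
  have ha' : ∀ m, 1 ≤ m → m ≤ N → a m = chainSum w 0 m := by
    intro m
    induction m using Nat.strong_induction_on with
    | _ m ih =>
      intro h1 hN
      rw [ha m h1 hN, chainSum_eq_add_sum_last w h1, hIco]
      congr 1
      refine Finset.sum_congr rfl fun j hj => ?_
      obtain ⟨h0j, hjm⟩ := Finset.mem_Ioo.1 hj
      rw [ih j hjm h0j (hjm.le.trans hN)]
  have hb' : ∀ d m, 1 ≤ m → m + d = N → b m = chainSum w m (N + 1) := by
    intro d
    induction d using Nat.strong_induction_on with
    | _ d ih =>
      intro m h1 hN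
      rw [hb m h1 (by omega), chainSum_eq_add_sum_first w (by omega), hIoc]
      congr 1
      refine Finset.sum_congr rfl fun j hj => ?_
      obtain ⟨hmj, hjN⟩ := Finset.mem_Ioo.1 hj
      rw [ih (N - j) (by omega) j (by omega) (by omega)]
  have hA' : A = chainSum w 0 (N + 1) := by
    have hIcc : Finset.Icc 1 N = Finset.Ioo 0 (N + 1) := by
      ext x; simp only [Finset.mem_Ioo, Finset.mem_Icc]; omega
    rw [hA, chainSum_eq_add_sum_last w (Nat.succ_pos N), ← hIcc]
    congr 1
    refine Finset.sum_congr rfl fun j hj => ?_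
    obtain ⟨h1j, hjN⟩ := Finset.mem_Icc.1 hj
    rw [ha' j h1j hjN]
  have hpos : 0 < A := hA' ▸ chainSum_pos hw (Nat.succ_pos N) le_rfl
  refine ⟨hpos, ?_⟩
  have hsum := Finset.sum_filter_add_sum_filter_not (Finset.Icc 1 N).powerset
    (fun I => k ∈ I) (PiW w N)
  rw [sum_PiW, sum_PiW_notMem w hk1 hkN, ← hA', ← ha' k hk1 hkN,
    ← hb' (N - k) k hk1 (by omega)] at hsum
  rw [eq_sub_of_add_eq hsum, sub_div, div_self hpos.ne']
end

section
/- Let N ≥ 1, p ∈ ℝ, f, G : ℝ → ℝ, C ∈ ℝ, and let t_s ≤ t_1 ≤ t_2 ≤ ... ≤ t_N ≤ t_e be real numbers. Define weights: w(0,k) = p^{k−1} · G(t_k − t_s) for 1 ≤ k ≤ N; w(0,N+1) = p^N · C; w(j,k) = (1−p) · p^{k−j−1} · f(t_k − t_j) for 1 ≤ j < k ≤ N; and w(k,N+1) = (1−p) · p^{N−k} · G(t_e − t_k) for 1 ≤ k ≤ N. Let A(t_s, t_1, ..., t_N, t_e) be the sum over all chains from 0 to N+1 of their weights. Define the time-reversed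 data t'_s = −t_e, t'_e = −t_s, and t'_k = −t_{N−k+1} for 1 ≤ k ≤ N. Then A(t'_s, t'_1, ..., t'_N, t'_e) = A(t_s, t_1, ..., t_N, t_e). -/
/-- The weights of the intrusion-detection DAG built from event times
`t 1, ..., t N` in the interval `[ts, te]`, interarrival density `f`,
boundary factor `G`, all-intrusion factor `C`, and prior intrusion
probability `p`:
* `w(0,k)     = p^(k-1) (1-p)⁰ G(t_k - ts)` for `1 ≤ k ≤ N`,
* `w(0,N+1)   = p^N C`,
* `w(j,k)     = (1-p) p^(k-j-1) f(t_k - t_j)` for `1 ≤ j < k ≤ N`,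
* `w(k,N+1)   = (1-p) p^(N-k) G(te - t_k)` for `1 ≤ k ≤ N`. -/
noncomputable def intrusionW (N : ℕ) (p : ℝ) (f G : ℝ → ℝ) (C : ℝ)
    (ts te : ℝ) (t : ℕ → ℝ) (i j : ℕ) : ℝ :=
  if i = 0 then
    (if j = N + 1 then p ^ N * C else p ^ (j - 1) * G (t j - ts))
  else if j = N + 1 then (1 - p) * p ^ (N - i) * G (te - t i)
  else (1 - p) * p ^ (j - i - 1) * f (t j - t i)

/-- The weight `intrusionW` without the factors `1 - p`. -/
noncomputable def strippedW (N : ℕ) (p : ℝ) (f G : ℝ → ℝ) (C : ℝ)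
    (ts te : ℝ) (t : ℕ → ℝ) (i j : ℕ) : ℝ :=
  if i = 0 then
    (if j = N + 1 then p ^ N * C else p ^ (j - 1) * G (t j - ts))
  else if j = N + 1 then p ^ (N - i) * G (te - t i)
  else p ^ (j - i - 1) * f (t j - t i)

theorem chainWeight_append_pair (w : ℕ → ℕ → ℝ) (l : List ℕ) (a b : ℕ) :
    chainWeight w (l ++ [a, b]) = chainWeight w (l ++ [a]) * w a b := by
  induction l with
  | nil => simp [chainWeight]
  | cons c l ih =>
    cases l with
    | nil => simp [chainWeight]
    | cons d l =>
      simp only [List.cons_append, chainWeight] at ih ⊢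
      rw [ih, mul_assoc]

theorem chainWeight_reverse (w : ℕ → ℕ → ℝ) (l : List ℕ) :
    chainWeight w l.reverse = chainWeight (fun a b => w b a) l := by
  induction l with
  | nil => simp [chainWeight]
  | cons c l ih =>
    cases l with
    | nil => simp [chainWeight]
    | cons d l =>
      have h := chainWeight_append_pair w l.reverse d c
      simp only [List.reverse_cons, List.append_assoc, List.cons_append, List.nil_append,
        chainWeight] at ih h ⊢
      rw [h, ih, mul_comm]

theorem chainWeight_map (w : ℕ → ℕ → ℝ) (g : ℕ → ℕ) (l : List ℕ) :
    chainWeight w (l.map g) = chainWeight (fun a b => w (g a) (g b)) l := by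
  induction l with
  | nil => simp [chainWeight]
  | cons c l ih =>
    cases l with
    | nil => simp [chainWeight]
    | cons d l =>
      simp only [List.map_cons, chainWeight] at ih ⊢
      rw [ih]

theorem chainWeight_congr {w v : ℕ → ℕ → ℝ} {M : ℕ}
    (h : ∀ a b, a < b → b ≤ M → w a b = v a b) {l : List ℕ}
    (hl : l.Pairwise (· < ·)) (hM : ∀ x ∈ l, x ≤ M) :
    chainWeight w l = chainWeight v l := by
  induction l with
  | nil => simp [chainWeight]
  | cons c l ih =>
    cases l with
    | nil => simp [chainWeight]
    | cons d l =>
      have ih' := ih hl.of_cons fun x hx => hM x (List.mem_cons_of_mem _ hx)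
      simp only [chainWeight]
      rw [ih', h c d (List.rel_of_pairwise_cons hl (by simp)) (hM d (by simp))]

theorem chainWeight_const_mul {w v : ℕ → ℕ → ℝ} {c : ℝ}
    (h : ∀ a b, a ≠ 0 → w a b = c * v a b) (l : List ℕ) (j : ℕ) (hl : ∀ x ∈ l, x ≠ 0) :
    chainWeight w (l ++ [j]) = c ^ l.length * chainWeight v (l ++ [j]) := by
  induction l with
  | nil => simp [chainWeight]
  | cons a l ih =>
    have ih' := ih fun x hx => hl x (List.mem_cons_of_mem _ hx)
    have ha := hl a (by simp)
    cases l with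
    | nil => simp [chainWeight, h a j ha]
    | cons d l =>
      simp only [List.cons_append, chainWeight, List.length_cons] at ih' ⊢
      rw [ih', h a d ha]
      ring

theorem chainWeight_intrusionW (N : ℕ) (p : ℝ) (f G : ℝ → ℝ) (C ts te : ℝ) (t : ℕ → ℝ)
    {S : Finset ℕ} (hS : S ⊆ Finset.Ioo 0 (N + 1)) :
    chainWeight (intrusionW N p f G C ts te t) (chainList 0 (N + 1) S) =
      (1 - p) ^ S.card *
        chainWeight (strippedW N p f G C ts te t) (chainList 0 (N + 1) S) := by
  have key := chainWeight_const_mul (w := intrusionW N p f G C ts te t)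
    (v := strippedW N p f G C ts te t) (c := 1 - p)
    (fun a b ha => by
      simp only [intrusionW, strippedW, ha, if_false]
      split_ifs <;> ring)
    (S.sort (· ≤ ·)) (N + 1) (fun x hx => by
      have := Finset.mem_Ioo.1 (hS ((Finset.mem_sort _).1 hx))
      omega)
  have h0 : ∀ b, intrusionW N p f G C ts te t 0 b = strippedW N p f G C ts te t 0 b :=
    fun b => by simp [intrusionW, strippedW]
  rw [Finset.length_sort] at key
  unfold chainList
  rw [List.cons_append]
  generalize S.sort (· ≤ ·) ++ [N + 1] = l at key ⊢
  cases l with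
  | nil => simpa [chainWeight] using key
  | cons d l =>
    rw [chainWeight, chainWeight, key, h0]
    ring

theorem mem_chainList {i j x : ℕ} {S : Finset ℕ} :
    x ∈ chainList i j S ↔ x = i ∨ x ∈ S ∨ x = j := by
  simp [chainList]

theorem pairwise_chainList {i j : ℕ} (hij : i < j) {S : Finset ℕ}
    (hS : S ⊆ Finset.Ioo i j) : (chainList i j S).Pairwise (· < ·) := by
  unfold chainList
  rw [List.cons_append, List.pairwise_cons, List.pairwise_append]
  refine ⟨fun x hx => ?_, S.sortedLT_sort.pairwise, by simp, fun x hx y hy => ?_⟩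
  · rcases List.mem_append.1 hx with hx | hx
    · exact (Finset.mem_Ioo.1 (hS ((Finset.mem_sort _).1 hx))).1
    · rw [List.mem_singleton.1 hx]
      exact hij
  · rw [List.mem_singleton.1 hy]
    exact (Finset.mem_Ioo.1 (hS ((Finset.mem_sort _).1 hx))).2

theorem image_sub_subset_Ioo {M : ℕ} {S : Finset ℕ} (hS : S ⊆ Finset.Ioo 0 M) :
    S.image (M - ·) ⊆ Finset.Ioo 0 M := by
  intro x hx
  obtain ⟨y, hy, rfl⟩ := Finset.mem_image.1 hx
  have := Finset.mem_Ioo.1 (hS hy)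
  rw [Finset.mem_Ioo]
  omega

theorem image_sub_image_sub {M : ℕ} {S : Finset ℕ} (hS : S ⊆ Finset.Ioo 0 M) :
    (S.image (M - ·)).image (M - ·) = S := by
  rw [Finset.image_image]
  refine (Finset.image_congr fun x hx => ?_).trans Finset.image_id
  have := Finset.mem_Ioo.1 (hS hx)
  simp only [Function.comp_apply, id]
  omega

theorem card_image_sub {M : ℕ} {S : Finset ℕ} (hS : S ⊆ Finset.Ioo 0 M) :
    (S.image (M - ·)).card = S.card := by
  refine Finset.card_image_of_injOn fun x hx y hy hxy => ?_
  have := Finset.mem_Ioo.1 (hS hx)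
  have := Finset.mem_Ioo.1 (hS hy)
  omega

theorem chainList_image_sub {M : ℕ} (hM : 0 < M) {S : Finset ℕ}
    (hS : S ⊆ Finset.Ioo 0 M) :
    chainList 0 M (S.image (M - ·)) = ((chainList 0 M S).map (M - ·)).reverse := by
  have h1 := pairwise_chainList hM (image_sub_subset_Ioo hS)
  have hle : ∀ x ∈ chainList 0 M S, x ≤ M := fun x hx => by
    rcases mem_chainList.1 hx with rfl | hx | rfl
    · exact hM.le
    · exact (Finset.mem_Ioo.1 (hS hx)).2.le
    · exact le_rfl
  have h2 : (((chainList 0 M S).map (M - ·)).reverse).Pairwise (· < ·) := by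
    rw [List.pairwise_reverse, List.pairwise_map]
    refine (pairwise_chainList hM hS).imp_of_mem fun {a b} ha hb hab => ?_
    have := hle b hb
    omega
  refine List.Perm.eq_of_pairwise (fun a b _ _ hab hba => absurd hab hba.asymm) h1 h2 ?_
  refine (List.perm_ext_iff_of_nodup (h1.imp ne_of_lt) (h2.imp ne_of_lt)).2 fun x => ?_
  rw [List.mem_reverse, List.mem_map, mem_chainList]
  simp only [mem_chainList, Finset.mem_image]
  constructor
  · rintro (rfl | ⟨y, hy, rfl⟩ | rfl)
    · exact ⟨M, by simp, by simp⟩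
    · exact ⟨y, by simp [hy], rfl⟩
    · exact ⟨0, by simp, by simp⟩
  · rintro ⟨y, rfl | hy | rfl, rfl⟩
    · simp
    · exact Or.inr (Or.inl ⟨y, hy, rfl⟩)
    · simp

theorem strippedW_time_reversal (N : ℕ) (p : ℝ) (f G : ℝ → ℝ) (C ts te : ℝ) (t : ℕ → ℝ)
    {a b : ℕ} (hab : a < b) (hb : b ≤ N + 1) :
    strippedW N p f G C (-te) (-ts) (fun k => -t (N - k + 1)) a b =
      strippedW N p f G C ts te t (N + 1 - b) (N + 1 - a) := by
  have hsub : ∀ x y : ℝ, -x - -y = y - x := fun x y => by ring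
  unfold strippedW
  simp only [hsub]
  by_cases ha : a = 0 <;> by_cases hbN : b = N + 1
  · simp [ha, hbN]
  · have e1 : N - b + 1 = N + 1 - b := by omega
    have e2 : N - (N + 1 - b) = b - 1 := by omega
    have e3 : N + 1 - b ≠ 0 := by omega
    simp [ha, hbN, e1, e2, e3]
  · have e1 : N - a + 1 = N + 1 - a := by omega
    have e2 : N + 1 - a - 1 = N - a := by omega
    have e3 : N + 1 - a ≠ N + 1 := by omega
    simp only [ha, hbN, e1, e2, e3, if_true, if_false, Nat.sub_self]
  · have e1 : N - a + 1 = N + 1 - a := by omega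
    have e2 : N - b + 1 = N + 1 - b := by omega
    have e3 : N + 1 - a ≠ N + 1 := by omega
    have e4 : N + 1 - b ≠ 0 := by omega
    have e5 : N + 1 - a - (N + 1 - b) - 1 = b - a - 1 := by omega
    simp only [ha, hbN, e1, e2, e3, e4, e5, if_false]

theorem chainWeight_intrusionW_time_reversal (N : ℕ) (p : ℝ) (f G : ℝ → ℝ) (C ts te : ℝ)
    (t : ℕ → ℝ) {S : Finset ℕ} (hS : S ⊆ Finset.Ioo 0 (N + 1)) :
    chainWeight (intrusionW N p f G C (-te) (-ts) (fun k => -t (N - k + 1)))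
        (chainList 0 (N + 1) S) =
      chainWeight (intrusionW N p f G C ts te t)
        (chainList 0 (N + 1) (S.image (N + 1 - ·))) := by
  rw [chainWeight_intrusionW _ _ _ _ _ _ _ _ hS,
    chainWeight_intrusionW _ _ _ _ _ _ _ _ (image_sub_subset_Ioo hS), card_image_sub hS,
    chainList_image_sub N.succ_pos hS, chainWeight_reverse, chainWeight_map]
  congr 1
  refine chainWeight_congr (M := N + 1)
    (fun a b hab hb => strippedW_time_reversal N p f G C ts te t hab hb)
    (pairwise_chainList N.succ_pos hS) fun x hx => ?_
  rcases mem_chainList.1 hx with rfl | hx | rfl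
  · exact Nat.zero_le _
  · exact (Finset.mem_Ioo.1 (hS hx)).2.le
  · exact le_rfl

/-- the unnormalized marginal likelihood (the sum of the weights
of all chains from `0` to `N+1`) is invariant under time reversal
`ts' = -te`, `te' = -ts`, `t'_k = -t_{N-k+1}`. -/
theorem marginal_likelihood_time_reversal (N : ℕ) (hN : 1 ≤ N)
    (p : ℝ) (f G : ℝ → ℝ) (C : ℝ) (ts te : ℝ) (t : ℕ → ℝ)
    (h1 : ts ≤ t 1) (h2 : ∀ k, 1 ≤ k → k < N → t k ≤ t (k + 1))
    (h3 : t N ≤ te) :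
    chainSum (intrusionW N p f G C (-te) (-ts) (fun k => -t (N - k + 1)))
        0 (N + 1)
      = chainSum (intrusionW N p f G C ts te t) 0 (N + 1) := by
  unfold chainSum
  refine Finset.sum_bij' (fun S _ => S.image (N + 1 - ·)) (fun S _ => S.image (N + 1 - ·))
    ?_ ?_ ?_ ?_ ?_ <;> intro S hS <;> rw [Finset.mem_powerset] at hS
  · exact Finset.mem_powerset.2 (image_sub_subset_Ioo hS)
  · exact Finset.mem_powerset.2 (image_sub_subset_Ioo hS)
  · exact image_sub_image_sub hS
  · exact image_sub_image_sub hS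
  · exact chainWeight_intrusionW_time_reversal N p f G C ts te t hS
end
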